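/- For every SPECTRL specification φ over atomic predicates P_0 on a state space S, there exists a deterministic finite-state automaton D_φ over the alphabet 2^{P_0} such that for every trajectory ζ, ζ satisfies φ if and only if D_φ accepts the word L(ζ), where L is the labelling function mapping each state s to the set of atomic predicates true at s. -/

import Mathlib

/-- Predicates over a set `P0` of atomic predicates: conjunctions and
disjunctions of atomic predicates. -/
inductive BPred (P0 : Type) where
  | atom (p : P0)
  | and (b₁ b₂ : BPred P0)
  | or (b₁ b₂ : BPred P0)

/-- Satisfaction of a predicate at a state, given an interpretation `val` of the
atomic predicates. -/
def BPred.sat {P0 S : Type} (val : P0 → S → Prop) : BPred P0 → S → Prop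
  | .atom p, s => val p s
  | .and b₁ b₂, s => b₁.sat val s ∧ b₂.sat val s
  | .or b₁ b₂, s => b₁.sat val s ∨ b₂.sat val s

/-- Syntax of SPECTRL specifications over atomic predicates `P0`. -/
inductive Spec (P0 : Type) where
  | achieve (b : BPred P0)
  | ensuring (φ : Spec P0) (b : BPred P0)
  | seq (φ₁ φ₂ : Spec P0)
  | choice (φ₁ φ₂ : Spec P0)

/-- Satisfaction of a SPECTRL specification by a finite sequence of states
`s₀ s₁ … s_t`, given as a list. -/
def Spec.Sat {P0 S : Type} (val : P0 → S → Prop) : Spec P0 → List S → Prop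
  | .achieve b, l => ∃ s ∈ l, b.sat val s
  | .ensuring φ b, l => φ.Sat val l ∧ ∀ s ∈ l, b.sat val s
  | .seq φ₁ φ₂, l =>
      ∃ i : ℕ, i + 1 < l.length ∧ φ₁.Sat val (l.take (i + 1)) ∧ φ₂.Sat val (l.drop (i + 1))
  | .choice φ₁ φ₂, l => φ₁.Sat val l ∨ φ₂.Sat val l

/-- The labelling function `L : S → 2^{P0}` mapping a state to the set of atomic
predicates that hold at it. -/
def label {P0 S : Type} (val : P0 → S → Prop) (s : S) : Set P0 := {p | val p s}

namespace DFA

variable {α σ₁ σ₂ : Type}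

/-- The subset-construction automaton for the concatenation of two regular languages: it runs `M₁`
and keeps track of all states `M₂` can be in when started after an accepted prefix. -/
def concat (M₁ : DFA α σ₁) (M₂ : DFA α σ₂) : DFA α (σ₁ × Set σ₂) where
  step s a := (M₁.step s.1 a,
    {q | (∃ r ∈ s.2, M₂.step r a = q) ∨ (M₁.step s.1 a ∈ M₁.accept ∧ M₂.start = q)})
  start := (M₁.start, {q | M₁.start ∈ M₁.accept ∧ M₂.start = q})
  accept := {s | ∃ q ∈ s.2, q ∈ M₂.accept}

theorem eval_concat (M₁ : DFA α σ₁) (M₂ : DFA α σ₂) (x : List α) :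
    (M₁.concat M₂).eval x =
      (M₁.eval x, {q | ∃ u v, u ++ v = x ∧ M₁.eval u ∈ M₁.accept ∧ M₂.eval v = q}) := by
  induction x using List.reverseRecOn with
  | nil =>
    ext q
    · rfl
    · simp [concat]
  | append_singleton x a ih =>
    rw [eval_append_singleton, ih]
    ext q
    · simp [concat]
    · constructor
      · rintro (⟨r, ⟨u, v, rfl, hu, rfl⟩, rfl⟩ | ⟨h, rfl⟩)
        · exact ⟨u, v ++ [a], by simp, hu, by simp⟩
        · exact ⟨x ++ [a], [], by simp, by simpa using h, rfl⟩
      · rintro ⟨u, v, huv, hu, rfl⟩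
        rcases List.eq_nil_or_concat v with rfl | ⟨w, b, rfl⟩
        · obtain rfl : u = x ++ [a] := by simpa using huv
          exact Or.inr ⟨by simpa using hu, rfl⟩
        · rw [List.concat_eq_append, ← List.append_assoc] at huv
          obtain ⟨rfl, h⟩ := List.append_inj' huv rfl
          obtain rfl : b = a := by simpa using h
          exact Or.inl ⟨M₂.eval w, ⟨u, w, rfl, hu, rfl⟩, by simp⟩

theorem accepts_concat (M₁ : DFA α σ₁) (M₂ : DFA α σ₂) :
    (M₁.concat M₂).accepts = M₁.accepts * M₂.accepts := by
  ext x
  rw [mem_accepts, eval_concat, Language.mem_mul]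
  constructor
  · rintro ⟨q, ⟨u, v, huv, hu, rfl⟩, hq⟩
    exact ⟨u, hu, v, hq, huv⟩
  · rintro ⟨u, hu, v, hv, huv⟩
    exact ⟨_, ⟨u, v, huv, hu, rfl⟩, hv⟩

end DFA

namespace Language

variable {α : Type}

theorem IsRegular.mul {L₁ L₂ : Language α} (h₁ : L₁.IsRegular) (h₂ : L₂.IsRegular) :
    (L₁ * L₂).IsRegular := by
  classical
  obtain ⟨σ₁, _, M₁, rfl⟩ := h₁
  obtain ⟨σ₂, _, M₂, rfl⟩ := h₂
  exact ⟨σ₁ × Set σ₂, inferInstance, M₁.concat M₂, M₁.accepts_concat M₂⟩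

theorem isRegular_setOf_exists_mem (p : α → Prop) :
    IsRegular ({l | ∃ a ∈ l, p a} : Set (List α)) := by
  let M : DFA α Prop := ⟨fun q a => q ∨ p a, False, {q | q}⟩
  have key (l : List α) (q : Prop) : M.evalFrom q l ↔ q ∨ ∃ a ∈ l, p a := by
    induction l generalizing q with
    | nil => simp
    | cons a l ih =>
      rw [DFA.evalFrom_cons, ih]
      simp [M, or_assoc]
  refine ⟨Prop, inferInstance, M, Set.ext fun l => ?_⟩
  exact (key l False).trans (iff_of_eq (false_or _))

theorem isRegular_setOf_forall_mem (p : α → Prop) :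
    IsRegular ({l | ∀ a ∈ l, p a} : Set (List α)) := by
  have h : ({l | ∀ a ∈ l, p a} : Set (List α)) = {l | ∃ a ∈ l, ¬ p a}ᶜ := by
    ext l
    simp
  rw [h]
  exact (isRegular_setOf_exists_mem fun a => ¬ p a).compl

end Language

theorem BPred.sat_label {P0 S : Type} (val : P0 → S → Prop) (b : BPred P0) (s : S) :
    b.sat (fun p A => p ∈ A) (label val s) ↔ b.sat val s := by
  induction b with
  | atom p => rfl
  | and b₁ b₂ ih₁ ih₂ => exact and_congr ih₁ ih₂
  | or b₁ b₂ ih₁ ih₂ => exact or_congr ih₁ ih₂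

namespace Spec

variable {P0 S : Type}

theorem sat_map_label (val : P0 → S → Prop) (φ : Spec P0) (l : List S) :
    φ.Sat (fun p A => p ∈ A) (l.map (label val)) ↔ φ.Sat val l := by
  induction φ generalizing l with
  | achieve b => simp [Sat, BPred.sat_label]
  | ensuring φ b ih => simp [Sat, BPred.sat_label, ih]
  | seq φ₁ φ₂ ih₁ ih₂ => simp [Sat, ← List.map_take, ← List.map_drop, ih₁, ih₂]
  | choice φ₁ φ₂ ih₁ ih₂ => simp [Sat, ih₁, ih₂]

theorem not_sat_nil (val : P0 → S → Prop) (φ : Spec P0) : ¬ φ.Sat val [] := by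
  induction φ with
  | achieve b => simp [Sat]
  | ensuring φ b ih => simp [Sat, ih]
  | seq φ₁ φ₂ ih₁ ih₂ => simp [Sat]
  | choice φ₁ φ₂ ih₁ ih₂ => simp [Sat, ih₁, ih₂]

/-- The language of all state sequences satisfying a specification. -/
def language (val : P0 → S → Prop) (φ : Spec P0) : Language S := {l | φ.Sat val l}

theorem language_seq (val : P0 → S → Prop) (φ₁ φ₂ : Spec P0) :
    (seq φ₁ φ₂).language val = φ₁.language val * φ₂.language val := by
  ext l
  rw [Language.mem_mul]
  change Sat val _ l ↔ ∃ u, Sat val φ₁ u ∧ ∃ v, Sat val φ₂ v ∧ u ++ v = l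
  constructor
  · rintro ⟨i, -, h₁, h₂⟩
    exact ⟨_, h₁, _, h₂, List.take_append_drop _ l⟩
  · rintro ⟨u, hu, v, hv, rfl⟩
    cases u with
    | nil => exact absurd hu (not_sat_nil val φ₁)
    | cons a u =>
      cases v with
      | nil => exact absurd hv (not_sat_nil val φ₂)
      | cons b v => exact ⟨u.length, by simp, by simpa using hu, by simpa using hv⟩

theorem isRegular_language (val : P0 → S → Prop) (φ : Spec P0) :
    (φ.language val).IsRegular := by
  induction φ with
  | achieve b => exact Language.isRegular_setOf_exists_mem _
  | ensuring φ b ih => exact ih.inf (Language.isRegular_setOf_forall_mem (b.sat val))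
  | seq φ₁ φ₂ ih₁ ih₂ => exact language_seq val φ₁ φ₂ ▸ ih₁.mul ih₂
  | choice φ₁ φ₂ ih₁ ih₂ => exact ih₁.add ih₂

end Spec

/-- For every SPECTRL specification `φ` over atomic predicates
`P0` on a state space `S`, there is a deterministic finite-state automaton `D_φ`
over the alphabet `2^{P0}` such that a trajectory `ζ` (a nonempty sequence of
states) satisfies `φ` iff `D_φ` accepts the word `L(ζ)`. -/
theorem spectrl_to_dfa {P0 S : Type} (val : P0 → S → Prop) (φ : Spec P0) :
    ∃ (Q : Type) (_ : Fintype Q) (D : DFA (Set P0) Q),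
      ∀ (s : S) (l : List S),
        Spec.Sat val φ (s :: l) ↔ (s :: l).map (label val) ∈ D.accepts := by
  obtain ⟨Q, hQ, D, hD⟩ := φ.isRegular_language (fun p (A : Set P0) => p ∈ A)
  refine ⟨Q, hQ, D, fun s l => ?_⟩
  rw [hD]
  exact (φ.sat_map_label val (s :: l)).symm
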